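/- The operators Ř_i(u) satisfy the Yang–Baxter and unitarity equations: for all u, v ∈ K and 1 ≤ i ≤ 2n−2, Ř_i(u)·Ř_{i+1}(uv)·Ř_i(v) = Ř_{i+1}(v)·Ř_i(uv)·Ř_{i+1}(u) as operators on M; and for every nonzero u ∈ K and 1 ≤ i ≤ 2n−1, Ř_i(u⁻¹)·Ř_i(u) = (1−tu)(1−tu⁻¹)·Id. -/

import Mathlib

open Finset

noncomputable section

/-- The ambient field: fraction field of polynomials over `ℚ` in countably many
indeterminates; `qq`, `tt` and the `xx i`, `yy i` below are algebraically independent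
indeterminates, so identities among them are identities of rational functions
in `q`, `t` and the `x i` (and `y i`) over `ℚ`. -/
abbrev F : Type := FractionRing (MvPolynomial ℕ ℚ)

def gen (i : ℕ) : F := algebraMap (MvPolynomial ℕ ℚ) F (MvPolynomial.X i)

/-- the indeterminate `q` -/
def qq : F := gen 0
/-- the indeterminate `t` -/
def tt : F := gen 1
/-- the indeterminate `x_{i+1}` (0-based) -/
def xx (i : ℕ) : F := gen (2 + 2 * i)
/-- the indeterminate `y_{i+1}` (0-based) -/
def yy (i : ℕ) : F := gen (3 + 2 * i)

/-- labelings of the `2n` edge positions by values in `{1,…,n+1}` (0-based). -/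
abbrev Lab (n : ℕ) := Fin (2 * n) → Fin (n + 1)

abbrev Mat (n : ℕ) := Matrix (Lab n) (Lab n) F

/-- the structure constant `c((a,b),(a',b'))` of the generator `T`. -/
def Tcoeff (n : ℕ) (a b a' b' : Fin (n + 1)) : F :=
  if a' = a ∧ b' = b ∧ b < a then tt - 1
  else if a' = b ∧ b' = a ∧ a < b then 1
  else if a' = b ∧ b' = a ∧ b ≤ a then tt
  else 0

/-- the (standard, column-convention) matrix of `T_i` acting at 0-based positions `p, p+1`:
the `(κ, κ')` entry is the coefficient of `e_κ` in `T e_{κ'}`. -/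
def Tmat (n : ℕ) (p : ℕ) : Mat n :=
  Matrix.of fun κ κ' =>
    if h : p + 1 < 2 * n then
      if ∀ j : Fin (2 * n), (j : ℕ) ≠ p → (j : ℕ) ≠ p + 1 → κ j = κ' j then
        Tcoeff n (κ' ⟨p, by omega⟩) (κ' ⟨p + 1, h⟩) (κ ⟨p, by omega⟩) (κ ⟨p + 1, h⟩)
      else 0
    else 0

/-- `Ř_i(u) = (1−t)·Id + (1−u)·T_i` at 0-based position `p`. -/
def Rmat (n : ℕ) (p : ℕ) (u : F) : Mat n := (1 - tt) • (1 : Mat n) + (1 - u) • Tmat n p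

/-- the ordered product `Z = ∏_{j=1}^{n} (Ř_{n+j−1}(xₙ/y_j)·Ř_{n+j−2}(x_{n−1}/y_j)⋯Ř_j(x₁/y_j))`,
columns `j = 1,…,n` multiplied left to right (matrices in the standard convention, so that
an operator product written left to right is the corresponding matrix product). -/
def Zmat (n : ℕ) (x y : ℕ → F) : Mat n :=
  ((List.range n).map fun j =>
    ((List.range n).map fun r => Rmat n (j + (n - 1 - r)) (x (n - 1 - r) / y j)).prod).prod

/-- the labeling `(ω̄(v(1)),…,ω̄(v(2n)))` of `|v⟩` for `v ∈ Sₙ ⊂ S_{2n}`. -/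
def labP (n : ℕ) (v : Equiv.Perm (Fin n)) : Lab n := fun p =>
  if h : (p : ℕ) < n then Fin.castSucc (v ⟨p, h⟩) else Fin.last n

/-- the number of inversions (Coxeter length) of a permutation. -/
def ell {n : ℕ} (v : Equiv.Perm (Fin n)) : ℕ :=
  ((Finset.univ : Finset (Fin n × Fin n)).filter fun p => p.1 < p.2 ∧ v p.2 < v p.1).card

/-- `αₙ = (q/t)^{n(n−1)/2} (1−t)^{−n}`. -/
def alpha (n : ℕ) : F := (qq / tt) ^ (n * (n - 1) / 2) * (1 - tt)⁻¹ ^ n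

/-- the matrix element `F_v = ⟨1| Z |v⟩`. -/
def Fv (n : ℕ) (x y : ℕ → F) (v : Equiv.Perm (Fin n)) : F :=
  Zmat n x y (labP n 1) (labP n v)

open Equiv in
/-- The operator on functions of labelings given by the Hecke generator at positions `p, q`. -/
def heckeOp {N m : ℕ} (p q : Fin N) (f : (Fin N → Fin m) → F) (κ : Fin N → Fin m) : F :=
  if κ q < κ p then (tt - 1) * f κ + f (κ ∘ swap p q) else tt * f (κ ∘ swap p q)

open Equiv in
theorem comp_swap_eq_self {α β : Type*} [DecidableEq α] {κ : α → β} {p q : α}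
    (h : κ p = κ q) : κ ∘ swap p q = κ := by
  ext j
  rcases eq_or_ne j p with rfl | hp
  · simp [h]
  · rcases eq_or_ne j q with rfl | hq
    · simp [h]
    · simp [swap_apply_of_ne_of_ne hp hq]

open Equiv in
theorem heckeOp_sq {N m : ℕ} (p q : Fin N) (f : (Fin N → Fin m) → F) (κ : Fin N → Fin m) :
    heckeOp p q (heckeOp p q f) κ = (tt - 1) * heckeOp p q f κ + tt * f κ := by
  have hs : (κ ∘ swap p q) ∘ swap p q = κ := by ext j; simp
  simp only [heckeOp, hs, Function.comp_apply, swap_apply_left, swap_apply_right]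
  rcases lt_trichotomy (κ p) (κ q) with h | h | h
  · simp [h, h.not_gt]; ring
  · simp [h, comp_swap_eq_self h]; ring
  · simp [h, h.not_gt]

open Equiv in
theorem heckeOp_braid {N m : ℕ} {p q r : Fin N} (hpq : p ≠ q) (hqr : q ≠ r) (hpr : p ≠ r)
    (f : (Fin N → Fin m) → F) (κ : Fin N → Fin m) :
    heckeOp p q (heckeOp q r (heckeOp p q f)) κ =
      heckeOp q r (heckeOp p q (heckeOp q r f)) κ := by
  have hs (κ : Fin N → Fin m) (p q : Fin N) : (κ ∘ swap p q) ∘ swap p q = κ := by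
    ext j; simp
  have hb : ((κ ∘ swap q r) ∘ swap p q) ∘ swap q r = ((κ ∘ swap p q) ∘ swap q r) ∘ swap p q := by
    ext j
    by_cases h₁ : j = p
    · subst h₁; simp [swap_apply_of_ne_of_ne, hpq, hpr, hqr.symm, hpr.symm]
    by_cases h₂ : j = q
    · subst h₂; simp [swap_apply_of_ne_of_ne, *, Ne.symm]
    by_cases h₃ : j = r
    · subst h₃; simp [swap_apply_of_ne_of_ne, *, Ne.symm]
    simp [swap_apply_of_ne_of_ne, *]
  have e₁ : swap p q r = r := swap_apply_of_ne_of_ne hpr.symm hqr.symm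
  have e₂ : swap q r p = p := swap_apply_of_ne_of_ne hpq hpr
  have c₁ := @comp_swap_eq_self _ _ _ κ p q
  have c₂ := @comp_swap_eq_self _ _ _ κ q r
  have c₃ := @comp_swap_eq_self _ _ _ (κ ∘ swap p q) q r
  have c₄ := @comp_swap_eq_self _ _ _ (κ ∘ swap q r) p q
  have c₅ := @comp_swap_eq_self _ _ _ ((κ ∘ swap p q) ∘ swap q r) p q
  have c₆ := @comp_swap_eq_self _ _ _ ((κ ∘ swap q r) ∘ swap p q) q r
  simp only [heckeOp, hs, hb, Function.comp_apply, swap_apply_left, swap_apply_right, e₁, e₂]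
    at c₁ c₂ c₃ c₄ c₅ c₆ ⊢
  generalize ((κ ∘ swap p q) ∘ swap q r) ∘ swap p q = k₅ at *
  generalize (κ ∘ swap p q) ∘ swap q r = k₃ at *
  generalize (κ ∘ swap q r) ∘ swap p q = k₄ at *
  generalize κ ∘ swap p q = k₁ at *
  generalize κ ∘ swap q r = k₂ at *
  clear hs hb
  rcases lt_trichotomy (κ p) (κ q) with h | h | h <;>
  rcases lt_trichotomy (κ q) (κ r) with h' | h' | h' <;>
  rcases lt_trichotomy (κ p) (κ r) with h'' | h'' | h'' <;>
  first
    | (exfalso; omega)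
    | (simp_all [lt_asymm]; done)
    | (simp_all [lt_asymm]; ring)

open Equiv in
theorem Tmat_mulVec {n p : ℕ} (hp : p + 1 < 2 * n) (f : Lab n → F) :
    (Tmat n p).mulVec f = heckeOp ⟨p, by omega⟩ ⟨p + 1, hp⟩ f := by
  ext κ
  set P : Fin (2 * n) := ⟨p, by omega⟩ with hP
  set Q : Fin (2 * n) := ⟨p + 1, hp⟩ with hQ
  have key (κ' : Lab n) : Tmat n p κ κ' =
      (if κ' = κ then (if κ Q < κ P then tt - 1 else 0) else 0) +
      (if κ' = κ ∘ swap P Q then (if κ Q < κ P then 1 else tt) else 0) := by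
    have h₁ : κ' = κ ↔ (∀ j : Fin (2 * n), (j : ℕ) ≠ p → (j : ℕ) ≠ p + 1 → κ j = κ' j) ∧
        κ P = κ' P ∧ κ Q = κ' Q := by
      constructor
      · rintro rfl; simp
      · rintro ⟨h, hP', hQ'⟩
        ext1 j
        by_cases a : (j : ℕ) = p
        · rw [show j = P from Fin.ext a, hP']
        by_cases b : (j : ℕ) = p + 1
        · rw [show j = Q from Fin.ext b, hQ']
        exact (h j a b).symm
    have h₂ : κ' = κ ∘ swap P Q ↔
        (∀ j : Fin (2 * n), (j : ℕ) ≠ p → (j : ℕ) ≠ p + 1 → κ j = κ' j) ∧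
        κ P = κ' Q ∧ κ Q = κ' P := by
      constructor
      · rintro rfl
        refine ⟨fun j a b => ?_, by simp, by simp⟩
        rw [Function.comp_apply, swap_apply_of_ne_of_ne] <;>
          simpa [hP, hQ, Fin.ext_iff]
      · rintro ⟨h, hP', hQ'⟩
        ext1 j
        by_cases a : (j : ℕ) = p
        · rw [show j = P from Fin.ext a]; simp [hQ']
        by_cases b : (j : ℕ) = p + 1
        · rw [show j = Q from Fin.ext b]; simp [hP']
        rw [Function.comp_apply, swap_apply_of_ne_of_ne]
        · exact (h j a b).symm
        · simpa [hP, Fin.ext_iff]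
        · simpa [hQ, Fin.ext_iff]
    simp only [Tmat, Matrix.of_apply, dif_pos hp, Tcoeff, ← hP, ← hQ]
    by_cases hA : ∀ j : Fin (2 * n), (j : ℕ) ≠ p → (j : ℕ) ≠ p + 1 → κ j = κ' j
    · simp only [if_pos hA, h₁.trans (and_iff_right hA), h₂.trans (and_iff_right hA)]
      generalize κ P = a, κ Q = b, κ' P = c, κ' Q = d
      split_ifs <;> first | (exfalso; omega) | simp
    · simp only [h₁, h₂, hA, false_and, if_false, add_zero]
  simp only [Matrix.mulVec, dotProduct, key, add_mul, ite_mul, zero_mul, Finset.sum_add_distrib,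
    Finset.sum_ite_eq', Finset.mem_univ, if_true, heckeOp]
  split_ifs <;> simp

theorem Tmat_sq {n p : ℕ} (hp : p + 1 < 2 * n) :
    Tmat n p * Tmat n p = (tt - 1) • Tmat n p + tt • (1 : Mat n) := by
  refine Matrix.ext_of_mulVec_single fun κ => ?_
  rw [← Matrix.mulVec_mulVec, Matrix.add_mulVec, Matrix.smul_mulVec, Matrix.smul_mulVec,
    Matrix.one_mulVec, Tmat_mulVec hp, Tmat_mulVec hp]
  ext κ'
  exact heckeOp_sq _ _ _ _

theorem Tmat_braid {n p : ℕ} (hp : p + 2 < 2 * n) :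
    Tmat n p * Tmat n (p + 1) * Tmat n p = Tmat n (p + 1) * Tmat n p * Tmat n (p + 1) := by
  refine Matrix.ext_of_mulVec_single fun κ => ?_
  simp only [← Matrix.mulVec_mulVec, Tmat_mulVec (show p + 1 < 2 * n by omega),
    Tmat_mulVec (show p + 1 + 1 < 2 * n from hp)]
  ext κ'
  exact heckeOp_braid (by simp) (by simp) (by simp [add_assoc]) _ _

/-- Baxterization: the linear expressions in two Hecke generators satisfy the
Yang–Baxter equation. -/
theorem yangBaxter_of_hecke {K R : Type*} [CommRing K] [Ring R] [Algebra K R] (t u v : K)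
    {A B : R} (hA : A * A = (t - 1) • A + t • (1 : R)) (hB : B * B = (t - 1) • B + t • (1 : R))
    (hAB : A * B * A = B * A * B) :
    ((1 - t) • (1 : R) + (1 - u) • A) * ((1 - t) • (1 : R) + (1 - u * v) • B) *
        ((1 - t) • (1 : R) + (1 - v) • A) =
      ((1 - t) • (1 : R) + (1 - v) • B) * ((1 - t) • (1 : R) + (1 - u * v) • A) *
        ((1 - t) • (1 : R) + (1 - u) • B) := by
  simp only [add_mul, mul_add, smul_mul_assoc, mul_smul_comm, one_mul, mul_one, hA, hB, hAB]
  module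

/-- Unitarity of the linear expressions in a Hecke generator. -/
theorem unitarity_of_hecke {K R : Type*} [Field K] [Ring R] [Algebra K R] (t : K) {u : K}
    (hu : u ≠ 0) {A : R} (hA : A * A = (t - 1) • A + t • (1 : R)) :
    ((1 - t) • (1 : R) + (1 - u⁻¹) • A) * ((1 - t) • (1 : R) + (1 - u) • A) =
      ((1 - t * u) * (1 - t * u⁻¹)) • (1 : R) := by
  have h : u * u⁻¹ = 1 := mul_inv_cancel₀ hu
  simp only [add_mul, mul_add, smul_mul_assoc, mul_smul_comm, one_mul, mul_one, hA]
  match_scalars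
  · linear_combination (t - t ^ 2) * h
  · linear_combination (t - 1) * h

/-- the Yang–Baxter and unitarity equations for the `Ř`-matrices (0-based positions:
`Ř` at position `p` acts at `p, p+1`; the paper's `Ř_i` is `Rmat n (i-1)`). -/
theorem statement13 (n : ℕ) :
    (∀ u v : F, ∀ i : ℕ, i + 2 < 2 * n →
        Rmat n i u * Rmat n (i + 1) (u * v) * Rmat n i v =
          Rmat n (i + 1) v * Rmat n i (u * v) * Rmat n (i + 1) u) ∧
      ∀ u : F, u ≠ 0 → ∀ i : ℕ, i + 1 < 2 * n →
        Rmat n i u⁻¹ * Rmat n i u = ((1 - tt * u) * (1 - tt * u⁻¹)) • (1 : Mat n) := by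
  exact ⟨fun u v i hi =>
      yangBaxter_of_hecke tt u v (Tmat_sq (by omega)) (Tmat_sq hi) (Tmat_braid hi),
    fun u hu i hi => unitarity_of_hecke tt hu (Tmat_sq hi)⟩
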